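/- For every p ∈ [1, ∞) there exists a constant N = N(p) > 0 with the following property. Let f be an adapted random field on [0,1] × 𝕋 such that ‖f‖_{C^{0,1/2}} := sup_{(t,x)} ‖f(t,x)‖_{L_p(Ω)} + sup_{t∈[0,1]} sup_{x≠y} ‖f(t,x) − f(t,y)‖_{L_p(Ω)} / d(x,y)^{1/2} < ∞ and [f]_{𝒱_p^{1/4}[0,1]} < ∞. Then ‖f‖_{C^{1/4,1/2}} := sup_{(t,x)} ‖f(t,x)‖_{L_p(Ω)} + sup_{x∈𝕋} sup_{s≠t} ‖f(t,x) − f(s,x)‖_{L_p(Ω)} / |t − s|^{1/4} + sup_{t∈[0,1]} sup_{x≠y} ‖f(t,x) − f(t,y)‖_{L_p(Ω)} / d(x,y)^{1/2} ≤ N [f]_{𝒱_p^{1/4}[0,1]} + N ‖f‖_{C^{0,1/2}}. -/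

import Mathlib

open MeasureTheory Real Set ENNReal

noncomputable section

instance fact01 : Fact ((0:ℝ) < 1) := ⟨one_pos⟩

/-- The Gaussian heat kernel on `ℝ`: `p^ℝ_t(z) = (4πt)^(-1/2) exp(-z²/(4t))`. -/
def gaussKer (t z : ℝ) : ℝ := (4 * π * t) ^ (-(1:ℝ)/2) * Real.exp (-(z ^ 2) / (4 * t))

/-- The periodized heat kernel, as a (1-periodic) function of a real representative:
`a ↦ ∑_{k ∈ ℤ} p^ℝ_t(a + k)`. -/
def perKer (t a : ℝ) : ℝ := ∑' k : ℤ, gaussKer t (a + (k : ℝ))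

/-- The heat kernel on the torus `𝕋 = ℝ/ℤ`:
`p_t(x,y) = ∑_{k ∈ ℤ} p^ℝ_t(x - y + k)`, defined via the representative of `x - y` in `[0,1)`. -/
def heatKer (t : ℝ) (x y : UnitAddCircle) : ℝ :=
  AddCircle.liftIco 1 0 (perKer t) (x - y)

/-- The conditional `L_{p,∞}^𝒢`-norm of a random variable `X`:
`‖X‖_{L_{p,∞}^𝒢} = ess sup_ω (E[|X|^p | 𝒢])^{1/p}`, valued in `ℝ≥0∞`. -/
def condLpInf {Ω : Type*} {m0 : MeasurableSpace Ω} (μ : Measure Ω) (G : MeasurableSpace Ω)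
    (p : ℝ) (X : Ω → ℝ) : ℝ≥0∞ :=
  eLpNorm (fun ω => (μ[fun ω' => |X ω'| ^ p|G]) ω ^ (1 / p)) ∞ μ

/-- The bracket `[f]_{𝒱_p^γ[S,T]}` of a random field `f : [0,1] × 𝕋 × Ω → ℝ`:
`sup_{x ∈ 𝕋} sup_{S ≤ s < t ≤ T} (t−s)^{−γ} ‖f(t,x) − P_{t−s} f(s,·)(x)‖_{L_{p,∞}^{ℱ_s}}`,
where `P_{t−s} f(s,·)(x)(ω) = ∫_𝕋 p_{t−s}(x,y) f(s,y,ω) dy`. Valued in `ℝ≥0∞`. -/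
def Vbracket {Ω : Type*} {m0 : MeasurableSpace Ω} (μ : Measure Ω) (ℱ : Filtration ℝ m0)
    (p γ S T : ℝ) (f : ℝ → UnitAddCircle → Ω → ℝ) : ℝ≥0∞ :=
  ⨆ (x : UnitAddCircle) (s : ℝ) (t : ℝ) (_ : S ≤ s) (_ : s < t) (_ : t ≤ T),
    ENNReal.ofReal ((t - s) ^ (-γ)) *
      condLpInf μ (ℱ s) p (fun ω => f t x ω - ∫ y, heatKer (t - s) x y * f s y ω)

/-- `sup_{(t,x) ∈ [0,1] × 𝕋} ‖f(t,x)‖_{L_p(Ω)}`, valued in `ℝ≥0∞`. -/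
def supLpNorm {Ω : Type*} {m0 : MeasurableSpace Ω} (μ : Measure Ω) (p : ℝ)
    (f : ℝ → UnitAddCircle → Ω → ℝ) : ℝ≥0∞ :=
  ⨆ (t : ℝ) (_ : t ∈ Set.Icc (0:ℝ) 1) (x : UnitAddCircle),
    eLpNorm (f t x) (ENNReal.ofReal p) μ

/-- The spatial Hölder-`1/2` seminorm
`sup_{t ∈ [0,1]} sup_{x ≠ y} ‖f(t,x) − f(t,y)‖_{L_p} / d(x,y)^{1/2}`, valued in `ℝ≥0∞`. -/
def spaceHolderHalf {Ω : Type*} {m0 : MeasurableSpace Ω} (μ : Measure Ω) (p : ℝ)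
    (f : ℝ → UnitAddCircle → Ω → ℝ) : ℝ≥0∞ :=
  ⨆ (t : ℝ) (_ : t ∈ Set.Icc (0:ℝ) 1) (x : UnitAddCircle) (y : UnitAddCircle) (_ : x ≠ y),
    eLpNorm (fun ω => f t x ω - f t y ω) (ENNReal.ofReal p) μ /
      ENNReal.ofReal (dist x y ^ ((1:ℝ)/2))

/-- The temporal Hölder-`1/4` seminorm
`sup_{x ∈ 𝕋} sup_{s ≠ t, s,t ∈ [0,1]} ‖f(t,x) − f(s,x)‖_{L_p} / |t − s|^{1/4}`,
valued in `ℝ≥0∞`. -/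
def timeHolderQuarter {Ω : Type*} {m0 : MeasurableSpace Ω} (μ : Measure Ω) (p : ℝ)
    (f : ℝ → UnitAddCircle → Ω → ℝ) : ℝ≥0∞ :=
  ⨆ (x : UnitAddCircle) (s : ℝ) (_ : s ∈ Set.Icc (0:ℝ) 1) (t : ℝ) (_ : t ∈ Set.Icc (0:ℝ) 1)
    (_ : s ≠ t),
    eLpNorm (fun ω => f t x ω - f s x ω) (ENNReal.ofReal p) μ /
      ENNReal.ofReal (|t - s| ^ ((1:ℝ)/4))


lemma gaussKer_eq_gaussianPDFReal {t : ℝ} (ht : 0 < t) (z : ℝ) :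
    gaussKer t z = ProbabilityTheory.gaussianPDFReal 0 (2 * t).toNNReal z := by
  have h : ((2 * t).toNNReal : ℝ) = 2 * t := Real.coe_toNNReal _ (by positivity)
  rw [gaussKer, ProbabilityTheory.gaussianPDFReal, h, Real.sqrt_eq_rpow, neg_div,
    Real.rpow_neg (by positivity)]
  congr 2 <;> ring_nf

lemma gaussKer_nonneg {t : ℝ} (ht : 0 < t) (z : ℝ) : 0 ≤ gaussKer t z := by
  rw [gaussKer_eq_gaussianPDFReal ht]
  exact ProbabilityTheory.gaussianPDFReal_nonneg _ _ _

lemma measurable_gaussKer (t : ℝ) : Measurable (gaussKer t) := by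
  unfold gaussKer
  fun_prop

lemma perKer_eq_toReal {t : ℝ} (ht : 0 < t) (a : ℝ) :
    perKer t a = (∑' k : ℤ, ENNReal.ofReal (gaussKer t (a + k))).toReal := by
  rw [ENNReal.tsum_toReal_eq fun _ => ENNReal.ofReal_ne_top, perKer]
  simp only [ENNReal.toReal_ofReal (gaussKer_nonneg ht _)]

lemma measurable_perKer {t : ℝ} (ht : 0 < t) : Measurable (perKer t) := by
  have h : perKer t = fun a => (∑' k : ℤ, ENNReal.ofReal (gaussKer t (a + k))).toReal :=
    funext (perKer_eq_toReal ht)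
  rw [h]
  refine Measurable.ennreal_toReal (Measurable.tsum fun k => ?_)
  exact ((measurable_gaussKer t).comp (measurable_id.add_const _)).ennreal_ofReal

lemma perKer_nonneg {t : ℝ} (ht : 0 < t) (a : ℝ) : 0 ≤ perKer t a := by
  rw [perKer_eq_toReal ht]
  exact ENNReal.toReal_nonneg

lemma heatKer_nonneg {t : ℝ} (ht : 0 < t) (x y : UnitAddCircle) : 0 ≤ heatKer t x y :=
  perKer_nonneg ht _

lemma measurable_liftIco_perKer {t : ℝ} (ht : 0 < t) :
    Measurable (AddCircle.liftIco 1 0 (perKer t) : UnitAddCircle → ℝ) :=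
  ((measurable_perKer ht).comp measurable_subtype_coe).comp
    (AddCircle.measurableEquivIco 1 0).measurable

lemma measurable_heatKer {t : ℝ} (ht : 0 < t) (x : UnitAddCircle) :
    Measurable (heatKer t x) :=
  (measurable_liftIco_perKer ht).comp (measurable_const.sub measurable_id)

/-- Lebesgue integrals over `ℝ` are integrals over the unit interval of the periodization. -/
lemma lintegral_eq_setLIntegral_tsum_add_int (G : ℝ → ℝ≥0∞) (hG : Measurable G) :
    ∫⁻ z, G z = ∫⁻ a in Ioc (0:ℝ) 1, ∑' k : ℤ, G (a + k) := by
  rw [lintegral_tsum fun k : ℤ =>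
      (show Measurable fun a : ℝ => G (a + k) from hG.comp (measurable_id.add_const _)).aemeasurable,
    ← setLIntegral_univ, ← iUnion_Ioc_add_intCast (0:ℝ),
    lintegral_iUnion (fun _ => measurableSet_Ioc) (pairwise_disjoint_Ioc_add_intCast (0:ℝ))]
  refine tsum_congr fun k => ?_
  have h := (measurePreserving_add_right (volume : Measure ℝ) (k : ℝ)).setLIntegral_comp_preimage
    (measurableSet_Ioc (a := (0:ℝ) + k) (b := 0 + k + 1)) hG
  rw [← h]
  congr 2
  ext a
  simp [add_comm]

lemma lintegral_gaussianReal_eq {t : ℝ} (ht : 0 < t) (G : ℝ → ℝ≥0∞) (hG : Measurable G) :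
    ∫⁻ z, G z ∂(ProbabilityTheory.gaussianReal 0 (2 * t).toNNReal) =
      ∫⁻ a in Ioc (0:ℝ) 1, ∑' k : ℤ, ENNReal.ofReal (gaussKer t (a + k)) * G (a + k) := by
  have hv : (2 * t).toNNReal ≠ 0 := by simp [ht]
  rw [ProbabilityTheory.gaussianReal_of_var_ne_zero _ hv, lintegral_withDensity_eq_lintegral_mul _
    (ProbabilityTheory.measurable_gaussianPDF _ _) hG]
  have h : (ProbabilityTheory.gaussianPDF 0 (2 * t).toNNReal * G) =
      fun z => ENNReal.ofReal (gaussKer t z) * G z := by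
    ext z
    simp [ProbabilityTheory.gaussianPDF, gaussKer_eq_gaussianPDFReal ht]
  rw [h, lintegral_eq_setLIntegral_tsum_add_int]
  exact (measurable_gaussKer t).ennreal_ofReal.mul hG

/-- Integrating against the torus heat kernel is averaging over a Gaussian displacement. -/
lemma lintegral_heatKer_mul {t : ℝ} (ht : 0 < t) (x : UnitAddCircle)
    (F : UnitAddCircle → ℝ≥0∞) (hF : Measurable F) :
    ∫⁻ y, ENNReal.ofReal (heatKer t x y) * F y =
      ∫⁻ z : ℝ, F (x - z) ∂(ProbabilityTheory.gaussianReal 0 (2 * t).toNNReal) := by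
  have hmk : Measurable ((↑) : ℝ → UnitAddCircle) := AddCircle.measurable_mk'
  rw [lintegral_gaussianReal_eq ht (fun z => F (x - z)) (hF.comp (measurable_const.sub hmk)),
    ← lintegral_sub_left_eq_self _ x, ← UnitAddCircle.lintegral_preimage 0, zero_add]
  refine lintegral_congr_ae ?_
  have hfin : ∀ᵐ a ∂(volume.restrict (Ioc (0:ℝ) 1)),
      ∑' k : ℤ, ENNReal.ofReal (gaussKer t (a + k)) < ∞ := by
    refine ae_lt_top (Measurable.tsum fun k =>
      ((measurable_gaussKer t).comp (measurable_id.add_const _)).ennreal_ofReal) ?_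
    have h := lintegral_gaussianReal_eq ht (fun _ => 1) measurable_const
    simp only [lintegral_const, measure_univ, mul_one] at h
    rw [← h]
    exact ENNReal.one_ne_top
  have hmem : ∀ᵐ a ∂(volume.restrict (Ioc (0:ℝ) 1)), a ∈ Ico (0:ℝ) (0 + 1) := by
    rw [zero_add, ← restrict_Ico_eq_restrict_Ioc]
    exact ae_restrict_mem measurableSet_Ico
  filter_upwards [hfin, hmem] with a ha hm
  have hper : ∀ k : ℤ, ((a + k : ℝ) : UnitAddCircle) = a := fun k => by simp
  simp only [hper]
  rw [ENNReal.tsum_mul_right, heatKer, show x - (x - (a : UnitAddCircle)) = a by abel,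
    AddCircle.liftIco_coe_apply hm,
    perKer_eq_toReal ht, ENNReal.ofReal_toReal ha.ne]

/-- Gaussian absolute moments scale like powers of the standard deviation. -/
lemma lintegral_rpow_abs_gaussianReal {t : ℝ} (ht : 0 < t) (q : ℝ) :
    ∫⁻ z, ENNReal.ofReal (|z| ^ q) ∂(ProbabilityTheory.gaussianReal 0 (2 * t).toNNReal) =
      ENNReal.ofReal ((2 * t) ^ (q / 2)) *
        ∫⁻ z, ENNReal.ofReal (|z| ^ q) ∂(ProbabilityTheory.gaussianReal 0 1) := by
  have hmeas : Measurable fun z : ℝ => ENNReal.ofReal (|z| ^ q) := by fun_prop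
  have h := ProbabilityTheory.gaussianReal_map_const_mul (μ := 0) (v := 1) (√(2 * t))
  have hv : (NNReal.mk (√(2 * t) ^ 2) (sq_nonneg _) * 1) = (2 * t).toNNReal := by
    have h2 : 0 ≤ 2 * t := by positivity
    ext
    rw [NNReal.coe_mul, NNReal.coe_mk, Real.sq_sqrt h2, Real.coe_toNNReal _ h2, NNReal.coe_one,
      mul_one]
  rw [hv, mul_zero] at h
  rw [← h, lintegral_map hmeas (by fun_prop), ← lintegral_const_mul _ hmeas]
  refine lintegral_congr fun z => ?_
  rw [← ENNReal.ofReal_mul (by positivity), abs_mul, Real.mul_rpow (by positivity) (by positivity),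
    abs_of_nonneg (Real.sqrt_nonneg _), Real.sqrt_eq_rpow, ← Real.rpow_mul (by positivity)]
  congr 3
  ring_nf

lemma lintegral_rpow_abs_stdGaussian_lt_top {q : ℝ} (hq : 0 ≤ q) :
    ∫⁻ z, ENNReal.ofReal (|z| ^ q) ∂(ProbabilityTheory.gaussianReal 0 1) < ∞ := by
  rcases hq.eq_or_lt with rfl | hq
  · simp
  have h := ProbabilityTheory.memLp_id_gaussianReal (μ := 0) (v := 1) q.toNNReal
  have h2 := lintegral_rpow_enorm_lt_top_of_eLpNorm_lt_top (by simpa using hq) (by simp) h.2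
  refine lt_of_eq_of_lt (lintegral_congr fun z => ?_) h2
  simp only [id, ENNReal.coe_toReal, Real.coe_toNNReal _ hq.le]
  rw [← ENNReal.ofReal_rpow_of_nonneg (abs_nonneg _) hq.le, ← Real.norm_eq_abs, ofReal_norm]

/-- The `L_p` norm is dominated by the conditional `L_{p,∞}` norm. -/
lemma eLpNorm_le_condLpInf {Ω : Type*} {m0 : MeasurableSpace Ω} {μ : Measure Ω}
    [IsProbabilityMeasure μ] {G : MeasurableSpace Ω} (hG : G ≤ m0) {p : ℝ} (hp : 1 ≤ p)
    {X : Ω → ℝ} (hX : MemLp X (ENNReal.ofReal p) μ) :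
    eLpNorm X (ENNReal.ofReal p) μ ≤ condLpInf μ G p X := by
  have hp0 : 0 < p := by linarith
  have hpr : (ENNReal.ofReal p).toReal = p := ENNReal.toReal_ofReal hp0.le
  have hne : ENNReal.ofReal p ≠ 0 := by simpa using hp0
  have hint : Integrable (fun ω => |X ω| ^ p) μ := by
    have := hX.integrable_norm_rpow hne ENNReal.ofReal_ne_top
    rwa [hpr] at this
  have hnn : 0 ≤ᵐ[μ] μ[fun ω' => |X ω'| ^ p|G] :=
    condExp_nonneg (ae_of_all _ fun ω => by positivity)
  have hm : AEStronglyMeasurable[m0] (fun ω => (μ[fun ω' => |X ω'| ^ p|G]) ω ^ (1 / p)) μ :=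
    ((stronglyMeasurable_condExp.mono hG).measurable.pow_const _).aestronglyMeasurable
  refine le_trans (le_of_eq ?_) (eLpNorm_le_eLpNorm_of_exponent_le (p := ENNReal.ofReal p) le_top hm)
  rw [eLpNorm_eq_lintegral_rpow_enorm_toReal hne ENNReal.ofReal_ne_top,
    eLpNorm_eq_lintegral_rpow_enorm_toReal hne ENNReal.ofReal_ne_top, hpr]
  congr 1
  calc ∫⁻ ω, ‖X ω‖ₑ ^ p ∂μ = ∫⁻ ω, ENNReal.ofReal (|X ω| ^ p) ∂μ := by
        refine lintegral_congr fun ω => ?_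
        rw [← ENNReal.ofReal_rpow_of_nonneg (abs_nonneg _) hp0.le, ← Real.norm_eq_abs, ofReal_norm]
    _ = ENNReal.ofReal (∫ ω, (μ[fun ω' => |X ω'| ^ p|G]) ω ∂μ) := by
        rw [integral_condExp hG, ofReal_integral_eq_lintegral_ofReal hint
          (ae_of_all _ fun ω => by positivity)]
    _ = ∫⁻ ω, ENNReal.ofReal ((μ[fun ω' => |X ω'| ^ p|G]) ω) ∂μ :=
        ofReal_integral_eq_lintegral_ofReal integrable_condExp hnn
    _ = _ := by
        refine lintegral_congr_ae ?_
        filter_upwards [hnn] with ω hω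
        have hω : 0 ≤ (μ[fun ω' => |X ω'| ^ p|G]) ω := hω
        rw [Real.enorm_of_nonneg (by positivity), ENNReal.ofReal_rpow_of_nonneg (by positivity)
          hp0.le, ← Real.rpow_mul hω, one_div_mul_cancel hp0.ne', Real.rpow_one]

lemma lintegral_rpow_le_lintegral_rpow {α : Type*} [MeasurableSpace α] (ν : Measure α)
    [IsProbabilityMeasure ν] {p : ℝ} (hp : 1 ≤ p) {g : α → ℝ≥0∞} (hg : Measurable g) :
    (∫⁻ z, g z ∂ν) ^ p ≤ ∫⁻ z, g z ^ p ∂ν := by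
  have hp0 : 0 < p := by linarith
  have h := eLpNorm'_le_eLpNorm'_of_exponent_le (p := 1) (q := p) one_pos hp ν (f := g)
    hg.aestronglyMeasurable
  simp only [eLpNorm', enorm_eq_self, ENNReal.rpow_one, div_one] at h
  calc (∫⁻ z, g z ∂ν) ^ p ≤ ((∫⁻ z, g z ^ p ∂ν) ^ (1 / p)) ^ p := by gcongr
    _ = _ := by rw [← ENNReal.rpow_mul, one_div_mul_cancel hp0.ne', ENNReal.rpow_one]

lemma enorm_integral_heatKer_sub_le {t : ℝ} (ht : 0 < t) (x : UnitAddCircle)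
    (g : UnitAddCircle → ℝ) (hg : Measurable g) :
    ‖(∫ y, heatKer t x y * g y) - g x‖ₑ ≤
      ∫⁻ z : ℝ, ‖g x - g (x - z)‖ₑ ∂(ProbabilityTheory.gaussianReal 0 (2 * t).toNNReal) := by
  have hF : Measurable fun y => ‖g x - g y‖ₑ := (measurable_const.sub hg).enorm
  rw [← lintegral_heatKer_mul ht x _ hF]
  have hk := measurable_heatKer ht x
  have hone : ∫⁻ y, ENNReal.ofReal (heatKer t x y) = 1 := by
    simpa using lintegral_heatKer_mul ht x (fun _ => 1) measurable_const
  have hki : Integrable (heatKer t x) := by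
    refine ⟨hk.aestronglyMeasurable, ?_⟩
    rw [hasFiniteIntegral_iff_ofReal (ae_of_all _ (heatKer_nonneg ht x)), hone]
    exact ENNReal.one_lt_top
  have hk1 : ∫ y, heatKer t x y = 1 := by
    rw [integral_eq_lintegral_of_nonneg_ae (ae_of_all _ (heatKer_nonneg ht x))
      hk.aestronglyMeasurable, hone, ENNReal.toReal_one]
  have henorm : ∀ y, ENNReal.ofReal (heatKer t x y) * ‖g x - g y‖ₑ =
      ‖heatKer t x y * (g x - g y)‖ₑ := fun y => by
    rw [enorm_mul, Real.enorm_of_nonneg (heatKer_nonneg ht x y)]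
  simp only [henorm]
  rcases eq_or_ne (∫⁻ y, ‖heatKer t x y * (g x - g y)‖ₑ) ∞ with h | h
  · rw [h]
    exact le_top
  have hi : Integrable fun y => heatKer t x y * (g x - g y) :=
    ⟨(hk.mul (measurable_const.sub hg)).aestronglyMeasurable, lt_top_iff_ne_top.2 h⟩
  have heq : (∫ y, heatKer t x y * g y) - g x = -∫ y, heatKer t x y * (g x - g y) := by
    have h1 : (fun y => heatKer t x y * g y) =
        fun y => heatKer t x y * g x - heatKer t x y * (g x - g y) := by
      ext y
      ring
    rw [h1, integral_sub (hki.mul_const _) hi, integral_mul_const, hk1]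
    ring
  rw [heq, enorm_neg]
  exact enorm_integral_le_lintegral_enorm _

lemma eLpNorm_eq_rpow_lintegral {α : Type*} [MeasurableSpace α] {μ : Measure α} {p : ℝ}
    (hp : 0 < p) (g : α → ℝ) :
    eLpNorm g (ENNReal.ofReal p) μ = (∫⁻ ω, ‖g ω‖ₑ ^ p ∂μ) ^ (1 / p) := by
  rw [eLpNorm_eq_lintegral_rpow_enorm_toReal (by simpa using hp) ENNReal.ofReal_ne_top,
    ENNReal.toReal_ofReal hp.le]

/-- The `p`-th root of the absolute moment of order `p / 2` of the Gaussian law whose density is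
the heat kernel at time `1 / 2`, up to the factor coming from rescaling. -/
def heatMomentConst (p : ℝ) : ℝ≥0∞ :=
  ENNReal.ofReal (2 ^ ((1:ℝ) / 4)) *
    (∫⁻ z, ENNReal.ofReal (|z| ^ (p / 2)) ∂(ProbabilityTheory.gaussianReal 0 1)) ^ (1 / p)

lemma heatMomentConst_lt_top {p : ℝ} (hp : 0 < p) : heatMomentConst p < ∞ :=
  ENNReal.mul_lt_top ENNReal.ofReal_lt_top (ENNReal.rpow_lt_top_of_nonneg (by positivity)
    (lintegral_rpow_abs_stdGaussian_lt_top (by positivity)).ne)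

section RandomField

variable {Ω : Type*} {m0 : MeasurableSpace Ω} {μ : Measure Ω} {p : ℝ}
  {f : ℝ → UnitAddCircle → Ω → ℝ}

lemma eLpNorm_sub_le_spaceHolderHalf {s : ℝ} (hs : s ∈ Icc (0:ℝ) 1) (x y : UnitAddCircle) :
    eLpNorm (fun ω => f s x ω - f s y ω) (ENNReal.ofReal p) μ ≤
      spaceHolderHalf μ p f * ENNReal.ofReal (dist x y ^ ((1:ℝ)/2)) := by
  rcases eq_or_ne x y with rfl | hxy
  · simp
  have hd : 0 < dist x y ^ ((1:ℝ)/2) := Real.rpow_pos_of_pos (dist_pos.2 hxy) _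
  rw [← ENNReal.div_le_iff (by simpa using hd) ENNReal.ofReal_ne_top]
  exact le_iSup_of_le s <| le_iSup_of_le hs <| le_iSup_of_le x <| le_iSup_of_le y <|
    le_iSup_of_le hxy le_rfl

/-- The heat semigroup moves a spatially `1/2`-Hölder field by at most `t ^ (1/4)` in `L_p`. -/
lemma eLpNorm_integral_heatKer_sub_le [SFinite μ] (hp : 1 ≤ p) {s t : ℝ} (ht : 0 < t)
    (hs : s ∈ Icc (0:ℝ) 1) (x : UnitAddCircle)
    (hf : Measurable fun q : UnitAddCircle × Ω => f s q.1 q.2) :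
    eLpNorm (fun ω => (∫ y, heatKer t x y * f s y ω) - f s x ω) (ENNReal.ofReal p) μ ≤
      spaceHolderHalf μ p f * (heatMomentConst p * ENNReal.ofReal (t ^ ((1:ℝ)/4))) := by
  have hp0 : 0 < p := by linarith
  set ν := ProbabilityTheory.gaussianReal 0 (2 * t).toNNReal with hν
  set H := spaceHolderHalf μ p f
  have hmk : Measurable ((↑) : ℝ → UnitAddCircle) := AddCircle.measurable_mk'
  have hjoint : Measurable fun q : Ω × ℝ => ‖f s x q.1 - f s (x - q.2) q.1‖ₑ := by
    refine Measurable.enorm (Measurable.sub ?_ ?_)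
    · exact hf.comp (measurable_const.prodMk measurable_fst)
    · exact hf.comp ((measurable_const.sub (hmk.comp measurable_snd)).prodMk measurable_fst)
  have hdisp : ∀ z : ℝ, ∫⁻ ω, ‖f s x ω - f s (x - z) ω‖ₑ ^ p ∂μ ≤
      H ^ p * ENNReal.ofReal (|z| ^ (p / 2)) := by
    intro z
    have h := eLpNorm_sub_le_spaceHolderHalf (μ := μ) (p := p) (f := f) hs x (x - z)
    rw [eLpNorm_eq_rpow_lintegral hp0, one_div, ENNReal.rpow_inv_le_iff hp0,
      ENNReal.mul_rpow_of_nonneg _ _ hp0.le, ENNReal.ofReal_rpow_of_nonneg (by positivity) hp0.le,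
      ← Real.rpow_mul dist_nonneg] at h
    refine h.trans ?_
    have hd : dist x (x - z) ≤ |z| := by
      rw [dist_eq_norm, show x - (x - (z : UnitAddCircle)) = z by abel]
      exact QuotientAddGroup.norm_mk_le_norm
    gcongr
    rw [show (1:ℝ) / 2 * p = p / 2 by ring]
    exact Real.rpow_le_rpow dist_nonneg hd (by positivity)
  rw [eLpNorm_eq_rpow_lintegral hp0, one_div, ENNReal.rpow_inv_le_iff hp0]
  calc ∫⁻ ω, ‖(∫ y, heatKer t x y * f s y ω) - f s x ω‖ₑ ^ p ∂μ
      ≤ ∫⁻ ω, (∫⁻ z : ℝ, ‖f s x ω - f s (x - z) ω‖ₑ ∂ν) ^ p ∂μ := by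
        refine lintegral_mono fun ω => ENNReal.rpow_le_rpow ?_ hp0.le
        exact enorm_integral_heatKer_sub_le ht x (fun y => f s y ω)
          (hf.comp (measurable_id.prodMk measurable_const))
    _ ≤ ∫⁻ ω, ∫⁻ z : ℝ, ‖f s x ω - f s (x - z) ω‖ₑ ^ p ∂ν ∂μ :=
        lintegral_mono fun ω => lintegral_rpow_le_lintegral_rpow ν hp
          (hjoint.comp (measurable_const.prodMk measurable_id))
    _ = ∫⁻ z : ℝ, ∫⁻ ω, ‖f s x ω - f s (x - z) ω‖ₑ ^ p ∂μ ∂ν :=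
        lintegral_lintegral_swap (hjoint.pow_const p).aemeasurable
    _ ≤ ∫⁻ z : ℝ, H ^ p * ENNReal.ofReal (|z| ^ (p / 2)) ∂ν := lintegral_mono hdisp
    _ = (H * (heatMomentConst p * ENNReal.ofReal (t ^ ((1:ℝ)/4)))) ^ p := by
        rw [lintegral_const_mul _ (by fun_prop), hν,
          lintegral_rpow_abs_gaussianReal ht, heatMomentConst,
          ENNReal.mul_rpow_of_nonneg _ _ hp0.le, ENNReal.mul_rpow_of_nonneg _ _ hp0.le,
          ENNReal.mul_rpow_of_nonneg _ _ hp0.le, ← ENNReal.rpow_mul,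
          one_div_mul_cancel hp0.ne', ENNReal.rpow_one,
          ENNReal.ofReal_rpow_of_nonneg (by positivity) hp0.le,
          ENNReal.ofReal_rpow_of_nonneg (by positivity) hp0.le, ← Real.rpow_mul (by positivity),
          ← Real.rpow_mul (by positivity), Real.mul_rpow (by positivity) ht.le,
          ENNReal.ofReal_mul (by positivity)]
        ring_nf

lemma eLpNorm_time_increment_le [IsProbabilityMeasure μ] (ℱ : Filtration ℝ m0) (hp : 1 ≤ p)
    (hf : Measurable fun q : ℝ × UnitAddCircle × Ω => f q.1 q.2.1 q.2.2)
    (hS : supLpNorm μ p f < ∞) (hH : spaceHolderHalf μ p f < ∞) (x : UnitAddCircle) {s t : ℝ}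
    (hs : 0 ≤ s) (hst : s < t) (ht : t ≤ 1) :
    eLpNorm (fun ω => f t x ω - f s x ω) (ENNReal.ofReal p) μ ≤
      (Vbracket μ ℱ p (1/4) 0 1 f + heatMomentConst p * spaceHolderHalf μ p f) *
        ENNReal.ofReal ((t - s) ^ ((1:ℝ)/4)) := by
  have hp0 : 0 < p := by linarith
  have hp1 : (1 : ℝ≥0∞) ≤ ENNReal.ofReal p := by simpa using ENNReal.ofReal_le_ofReal hp
  have hr : 0 < t - s := sub_pos.2 hst
  have hsec : ∀ u : ℝ, Measurable fun q : UnitAddCircle × Ω => f u q.1 q.2 := fun u =>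
    hf.comp (measurable_const.prodMk measurable_id)
  have hmem : ∀ u ∈ Icc (0:ℝ) 1, MemLp (f u x) (ENNReal.ofReal p) μ := fun u hu =>
    ⟨((hsec u).comp (measurable_const.prodMk measurable_id)).aestronglyMeasurable,
      lt_of_le_of_lt (le_iSup_of_le u <| le_iSup_of_le hu <|
        le_iSup (fun y => eLpNorm (f u y) (ENNReal.ofReal p) μ) x) hS⟩
  have hsI : s ∈ Icc (0:ℝ) 1 := ⟨hs, hst.le.trans ht⟩
  have htI : t ∈ Icc (0:ℝ) 1 := ⟨hs.trans hst.le, ht⟩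
  set P : Ω → ℝ := fun ω => ∫ y, heatKer (t - s) x y * f s y ω with hP
  have hPm : StronglyMeasurable P := by
    refine StronglyMeasurable.integral_prod_right (f := fun ω y => heatKer (t - s) x y * f s y ω) ?_
    refine Measurable.stronglyMeasurable ?_
    exact ((measurable_heatKer hr x).comp measurable_snd).mul ((hsec s).comp measurable_swap)
  have hPs := eLpNorm_integral_heatKer_sub_le (μ := μ) hp hr hsI x (hsec s)
  have hPsMem : MemLp (fun ω => P ω - f s x ω) (ENNReal.ofReal p) μ := by
    refine ⟨hPm.aestronglyMeasurable.sub (hmem s hsI).1, lt_of_le_of_lt hPs ?_⟩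
    exact ENNReal.mul_lt_top hH
      (ENNReal.mul_lt_top (heatMomentConst_lt_top hp0) ENNReal.ofReal_lt_top)
  have htP : MemLp (fun ω => f t x ω - P ω) (ENNReal.ofReal p) μ := by
    have h := ((hmem t htI).sub (hmem s hsI)).sub hPsMem
    refine h.congr_norm (((hmem t htI).1).sub hPm.aestronglyMeasurable) (ae_of_all _ fun ω => ?_)
    simp
  have hV : ENNReal.ofReal ((t - s) ^ (-(1/4 : ℝ))) *
      eLpNorm (fun ω => f t x ω - P ω) (ENNReal.ofReal p) μ ≤ Vbracket μ ℱ p (1/4) 0 1 f :=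
    (mul_le_mul_right (eLpNorm_le_condLpInf (ℱ.le s) hp htP) _).trans <|
      le_iSup_of_le x <| le_iSup_of_le s <| le_iSup_of_le t <| le_iSup_of_le hs <|
        le_iSup_of_le hst <| le_iSup_of_le ht le_rfl
  have hcancel : ENNReal.ofReal ((t - s) ^ ((1:ℝ)/4)) *
      ENNReal.ofReal ((t - s) ^ (-(1/4 : ℝ))) = 1 := by
    rw [← ENNReal.ofReal_mul (by positivity), ← Real.rpow_add hr]
    simp
  calc eLpNorm (fun ω => f t x ω - f s x ω) (ENNReal.ofReal p) μ
      = eLpNorm ((fun ω => f t x ω - P ω) + fun ω => P ω - f s x ω) (ENNReal.ofReal p) μ := by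
        congr 1
        ext ω
        simp
    _ ≤ eLpNorm (fun ω => f t x ω - P ω) (ENNReal.ofReal p) μ +
        eLpNorm (fun ω => P ω - f s x ω) (ENNReal.ofReal p) μ :=
        eLpNorm_add_le htP.1 hPsMem.1 hp1
    _ = ENNReal.ofReal ((t - s) ^ ((1:ℝ)/4)) * (ENNReal.ofReal ((t - s) ^ (-(1/4 : ℝ))) *
          eLpNorm (fun ω => f t x ω - P ω) (ENNReal.ofReal p) μ) +
        eLpNorm (fun ω => P ω - f s x ω) (ENNReal.ofReal p) μ := by
        rw [← mul_assoc, hcancel, one_mul]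
    _ ≤ ENNReal.ofReal ((t - s) ^ ((1:ℝ)/4)) * Vbracket μ ℱ p (1/4) 0 1 f +
        spaceHolderHalf μ p f * (heatMomentConst p * ENNReal.ofReal ((t - s) ^ ((1:ℝ)/4))) := by
        gcongr
    _ = _ := by ring

lemma timeHolderQuarter_le [IsProbabilityMeasure μ] (ℱ : Filtration ℝ m0) (hp : 1 ≤ p)
    (hf : Measurable fun q : ℝ × UnitAddCircle × Ω => f q.1 q.2.1 q.2.2)
    (hS : supLpNorm μ p f < ∞) (hH : spaceHolderHalf μ p f < ∞) :
    timeHolderQuarter μ p f ≤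
      Vbracket μ ℱ p (1/4) 0 1 f + heatMomentConst p * spaceHolderHalf μ p f := by
  refine iSup_le fun x => iSup_le fun s => iSup_le fun hs => iSup_le fun t => iSup_le fun ht =>
    iSup_le fun hst => ?_
  refine ENNReal.div_le_of_le_mul ?_
  rcases lt_or_gt_of_ne hst with h | h
  · rw [abs_of_pos (sub_pos.2 h)]
    exact eLpNorm_time_increment_le ℱ hp hf hS hH x hs.1 h ht.2
  · rw [abs_sub_comm, abs_of_pos (sub_pos.2 h),
      show eLpNorm (fun ω => f t x ω - f s x ω) (ENNReal.ofReal p) μ =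
        eLpNorm (fun ω => f s x ω - f t x ω) (ENNReal.ofReal p) μ from
        eLpNorm_sub_comm (f t x) (f s x) _ _]
    exact eLpNorm_time_increment_le ℱ hp hf hS hH x ht.1 h hs.2

end RandomField

/-- For every `p ∈ [1,∞)` there is `N = N(p) > 0` with the following
property. If `f` is an adapted random field on `[0,1] × 𝕋` with
`‖f‖_{C^{0,1/2}} := sup_{(t,x)} ‖f(t,x)‖_{L_p} + sup_t [f(t,·)]_{C^{1/2}} < ∞` and
`[f]_{𝒱_p^{1/4}[0,1]} < ∞`, then
`‖f‖_{C^{1/4,1/2}} ≤ N [f]_{𝒱_p^{1/4}[0,1]} + N ‖f‖_{C^{0,1/2}}`. -/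
theorem stmt17 (p : ℝ) (hp : 1 ≤ p)
    {Ω : Type*} {m0 : MeasurableSpace Ω} (μ : Measure Ω) [IsProbabilityMeasure μ]
    (ℱ : Filtration ℝ m0) :
    ∃ N : ℝ, 0 < N ∧ ∀ f : ℝ → UnitAddCircle → Ω → ℝ,
      (Measurable fun q : ℝ × UnitAddCircle × Ω => f q.1 q.2.1 q.2.2) →
      (∀ t x, Measurable[ℱ t] (f t x)) →
      supLpNorm μ p f + spaceHolderHalf μ p f < ∞ →
      Vbracket μ ℱ p (1/4) 0 1 f < ∞ →
      supLpNorm μ p f + timeHolderQuarter μ p f + spaceHolderHalf μ p f ≤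
        ENNReal.ofReal N * Vbracket μ ℱ p (1/4) 0 1 f +
          ENNReal.ofReal N * (supLpNorm μ p f + spaceHolderHalf μ p f) := by
  have hC := heatMomentConst_lt_top (p := p) (by linarith)
  refine ⟨1 + (heatMomentConst p).toReal, by positivity, fun f hf _ hfin _ => ?_⟩
  have hS := lt_of_le_of_lt le_self_add hfin
  have hH := lt_of_le_of_lt le_add_self hfin
  have hN : ENNReal.ofReal (1 + (heatMomentConst p).toReal) = 1 + heatMomentConst p := by
    rw [ENNReal.ofReal_add zero_le_one ENNReal.toReal_nonneg, ENNReal.ofReal_toReal hC.ne,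
      ENNReal.ofReal_one]
  rw [hN]
  set S := supLpNorm μ p f
  set H := spaceHolderHalf μ p f
  set V := Vbracket μ ℱ p (1/4) 0 1 f
  set C := heatMomentConst p
  calc S + timeHolderQuarter μ p f + H ≤ S + (V + C * H) + H := by
        gcongr
        exact timeHolderQuarter_le ℱ hp hf hS hH
    _ ≤ S + (V + C * H) + H + (C * V + C * S) := le_self_add
    _ = (1 + C) * V + (1 + C) * (S + H) := by ring
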